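/- Let S be a (d+1)-term silting subcategory of K that is contravariantly finite in D. Then: (a) for any object X ∈ T(S) there exists an extriangle Z → H^{[−d+1,0]}(S) → X with S ∈ S and Z ∈ T(S); (b) T(S) = Fac_d(add H^{[−d+1,0]}(S)) = Fac_{d+1}(add H^{[−d+1,0]}(S)); (c) add H^{[−d+1,0]}(S) coincides with the class of E-projective objects of T(S). -/

import Mathlib

open CategoryTheory CategoryTheory.Limits CategoryTheory.Pretriangulated

universe v u

namespace PaperAIR

variable {C : Type u} [Category.{v} C] [Preadditive C] [HasZeroObject C]
  [HasShift C ℤ] [∀ n : ℤ, (shiftFunctor C n).Additive] [Pretriangulated C]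

/-- `f : X ⟶ Y` is a right `𝒳`-approximation of `Y` (relative to `𝒳 ∋ X`). -/
def IsRightApprox (𝒳 : Set C) {X Y : C} (f : X ⟶ Y) : Prop :=
  X ∈ 𝒳 ∧ ∀ X' ∈ 𝒳, ∀ g : X' ⟶ Y, ∃ h : X' ⟶ X, h ≫ f = g

/-- `𝒳` is contravariantly finite in `C`: every object admits a right `𝒳`-approximation. -/
def ContravariantlyFinite (𝒳 : Set C) : Prop :=
  ∀ Y : C, ∃ (X : C) (f : X ⟶ Y), IsRightApprox 𝒳 f

/-- `𝒳` is contravariantly finite in the full subcategory `𝒞`. -/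
def ContravariantlyFiniteIn (𝒞 𝒳 : Set C) : Prop :=
  ∀ Y ∈ 𝒞, ∃ (X : C) (f : X ⟶ Y), IsRightApprox 𝒳 f

/-- `𝒮` is presilting: `Hom(𝒮, 𝒮[i]) = 0` for all `i > 0`. -/
def IsPresilting (𝒮 : Set C) : Prop :=
  ∀ X ∈ 𝒮, ∀ Y ∈ 𝒮, ∀ i : ℤ, 0 < i → ∀ f : X ⟶ Y⟦i⟧, f = 0

/-- a (strictly full) triangulated subcategory, given by its class of objects. -/
structure IsTriangSub (T : Set C) : Prop where
  iso_closed : ∀ (X Y : C), (X ≅ Y) → X ∈ T → Y ∈ T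
  zero_mem : ∀ X : C, IsZero X → X ∈ T
  shift_mem : ∀ X ∈ T, X⟦(1 : ℤ)⟧ ∈ T
  unshift_mem : ∀ X ∈ T, X⟦(-1 : ℤ)⟧ ∈ T
  ext_mem : ∀ (T' : Triangle C), T' ∈ (distTriang C) → T'.obj₁ ∈ T → T'.obj₃ ∈ T → T'.obj₂ ∈ T

/-- a thick subcategory: a triangulated subcategory closed under direct summands. -/
structure IsThickSub (T : Set C) extends IsTriangSub T : Prop where
  summand_mem : ∀ (X Y : C) (i : X ⟶ Y) (r : Y ⟶ X), i ≫ r = 𝟙 X → Y ∈ T → X ∈ T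

/-- the smallest thick subcategory containing `𝒮`. -/
def thickClosure (𝒮 : Set C) : Set C :=
  {X | ∀ T : Set C, IsThickSub T → 𝒮 ⊆ T → X ∈ T}

/-- `𝒮` is a silting subcategory of `C`: presilting, and the smallest triangulated
subcategory containing `𝒮` is `C` itself. -/
def IsSilting (𝒮 : Set C) : Prop :=
  IsPresilting 𝒮 ∧ ∀ T : Set C, IsTriangSub T → 𝒮 ⊆ T → ∀ X : C, X ∈ T

/-- `𝒮` is a silting subcategory of the (thick, triangulated) subcategory `𝒦`:
presilting, and the smallest triangulated subcategory containing `𝒮` is `𝒦`. -/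
def IsSiltingIn (𝒦 𝒮 : Set C) : Prop :=
  𝒮 ⊆ 𝒦 ∧ IsPresilting 𝒮 ∧ ∀ T : Set C, IsTriangSub T → 𝒮 ⊆ T → 𝒦 ⊆ T

/-- the shift `𝒮[n]` of a class of objects (closed under isomorphism). -/
def shiftSet (𝒮 : Set C) (n : ℤ) : Set C :=
  {X | ∃ Y ∈ 𝒮, Nonempty (X ≅ Y⟦n⟧)}

/-- `𝒜 ∗ ℬ`: objects `Z` fitting in a triangle `A → Z → B → A[1]` with `A ∈ 𝒜`, `B ∈ ℬ`. -/
def star (𝒜 ℬ : Set C) : Set C :=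
  {Z | ∃ (A B : C) (_ : A ∈ 𝒜) (_ : B ∈ ℬ) (f : A ⟶ Z) (g : Z ⟶ B) (h : B ⟶ A⟦(1 : ℤ)⟧),
      Triangle.mk f g h ∈ (distTriang C)}

/-- `𝒮^{[p, p+n]} = 𝒮[p] ∗ 𝒮[p+1] ∗ ⋯ ∗ 𝒮[p+n]`. -/
def intervalFrom (𝒮 : Set C) (p : ℤ) : ℕ → Set C
  | 0 => shiftSet 𝒮 p
  | n + 1 => star (shiftSet 𝒮 p) (intervalFrom 𝒮 (p + 1) n)

/-- `C_𝒳^{≤ 0}`: objects `Y` with `Hom(𝒳, Y[i]) = 0` for all `i > 0`. -/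
def leZeroSet (𝒳 : Set C) : Set C :=
  {Y | ∀ X ∈ 𝒳, ∀ i : ℤ, 0 < i → ∀ f : X ⟶ Y⟦i⟧, f = 0}

/-- `C_𝒳^{≥ 0}`: objects `Y` with `Hom(𝒳, Y[i]) = 0` for all `i < 0`. -/
def geZeroSet (𝒳 : Set C) : Set C :=
  {Y | ∀ X ∈ 𝒳, ∀ i : ℤ, i < 0 → ∀ f : X ⟶ Y⟦i⟧, f = 0}

/-- `(L, G)` is a `t`-structure (with `L = D^{≤0}`, `G = D^{≥0}`). -/
structure IsTStr (L G : Set C) : Prop where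
  iso_le : ∀ (X Y : C), (X ≅ Y) → X ∈ L → Y ∈ L
  iso_ge : ∀ (X Y : C), (X ≅ Y) → X ∈ G → Y ∈ G
  shift_le : ∀ X ∈ L, X⟦(1 : ℤ)⟧ ∈ L
  shift_ge : ∀ X ∈ G, X⟦(-1 : ℤ)⟧ ∈ G
  hom_zero : ∀ X ∈ L, ∀ Y : C, Y⟦(1 : ℤ)⟧ ∈ G → ∀ f : X ⟶ Y, f = 0
  exists_tri : ∀ X : C, ∃ (A B : C) (f : A ⟶ X) (g : X ⟶ B) (h : B ⟶ A⟦(1 : ℤ)⟧),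
      Triangle.mk f g h ∈ (distTriang C) ∧ A ∈ L ∧ B⟦(1 : ℤ)⟧ ∈ G

/-- the `d`-extended heart `d`-`H = D^{≤0} ∩ D^{≥ -d+1}` of the `t`-structure
`(D_P^{≤0}, D_P^{≥0})` associated with `P`. -/
def extHeart (P : Set C) (d : ℕ) : Set C :=
  {X | X ∈ leZeroSet P ∧ X⟦(1 - (d : ℤ))⟧ ∈ geZeroSet P}

/-- an extriangle `A → B → Z` in the `d`-extended heart. -/
def Extriangle (P : Set C) (d : ℕ) (A B Z : C) : Prop :=
  A ∈ extHeart P d ∧ B ∈ extHeart P d ∧ Z ∈ extHeart P d ∧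
    ∃ (f : A ⟶ B) (g : B ⟶ Z) (h : Z ⟶ A⟦(1 : ℤ)⟧), Triangle.mk f g h ∈ (distTriang C)

/-- `Fac_s(𝒳)`: the `s`-factors of `𝒳` inside the `d`-extended heart. -/
def Fac (P : Set C) (d : ℕ) (𝒳 : Set C) : ℕ → Set C
  | 0 => extHeart P d
  | s + 1 => {Z | ∃ Z' ∈ Fac P d 𝒳 s, ∃ B ∈ 𝒳, Extriangle P d Z' B Z}

/-- `T(𝒮) = {X ∈ d-H ∣ Hom(𝒮, X[i]) = 0 for i > 0}`. -/
def TClass (P : Set C) (d : ℕ) (𝒮 : Set C) : Set C :=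
  {X | X ∈ extHeart P d ∧ ∀ A ∈ 𝒮, ∀ i : ℤ, 0 < i → ∀ f : A ⟶ X⟦i⟧, f = 0}

/-- `F(𝒮) = {X ∈ d-H ∣ Hom(𝒮, X[i]) = 0 for i ≤ 0}`. -/
def FClass (P : Set C) (d : ℕ) (𝒮 : Set C) : Set C :=
  {X | X ∈ extHeart P d ∧ ∀ A ∈ 𝒮, ∀ i : ℤ, i ≤ 0 → ∀ f : A ⟶ X⟦i⟧, f = 0}

/-- `(𝒯, ℱ)` is an `s`-torsion pair in the `d`-extended heart. -/
def IsSTorsionPair (P : Set C) (d : ℕ) (𝒯 ℱ : Set C) : Prop :=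
  (∀ T ∈ 𝒯, ∀ F ∈ ℱ, ∀ f : T ⟶ F, f = 0) ∧
  (∀ T ∈ 𝒯, ∀ F ∈ ℱ, ∀ f : T ⟶ F⟦(-1 : ℤ)⟧, f = 0) ∧
  (∀ X ∈ extHeart P d, ∃ (T' : C) (_ : T' ∈ 𝒯) (F' : C) (_ : F' ∈ ℱ), Extriangle P d T' X F')

/-- `M` is (a representative of) `H^{[-d+1,0]}(S)`: there is a triangle
`W → S → M → W[1]` with `W ∈ D^{≤ -d}` and `M ∈ d-H`. -/
def IsHTrunc (P : Set C) (d : ℕ) (S M : C) : Prop :=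
  M ∈ extHeart P d ∧
    ∃ (W : C) (f : W ⟶ S) (g : S ⟶ M) (h : M ⟶ W⟦(1 : ℤ)⟧),
      Triangle.mk f g h ∈ (distTriang C) ∧ W⟦-(d : ℤ)⟧ ∈ leZeroSet P

/-- `H^{[-d+1,0]}(𝒮)` as a class of objects. -/
def hTruncSet (P : Set C) (d : ℕ) (𝒮 : Set C) : Set C :=
  {M | ∃ S ∈ 𝒮, IsHTrunc P d S M}

/-- the additive closure of a class of objects: closure under finite direct sums
(expressed via binary biproduct diagrams and zero objects) and direct summands. -/
inductive AddClos (𝒮 : Set C) : C → Prop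
  | of (X : C) (hX : X ∈ 𝒮) : AddClos 𝒮 X
  | zero (X : C) (hX : IsZero X) : AddClos 𝒮 X
  | biprod (X Y Z : C) (i₁ : X ⟶ Z) (i₂ : Y ⟶ Z) (p₁ : Z ⟶ X) (p₂ : Z ⟶ Y)
      (h₁ : i₁ ≫ p₁ = 𝟙 X) (h₂ : i₂ ≫ p₂ = 𝟙 Y) (h₁₂ : i₁ ≫ p₂ = 0) (h₂₁ : i₂ ≫ p₁ = 0)
      (htot : p₁ ≫ i₁ + p₂ ≫ i₂ = 𝟙 Z) (hX : AddClos 𝒮 X) (hY : AddClos 𝒮 Y) : AddClos 𝒮 Z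
  | summand (X Y : C) (i : X ⟶ Y) (r : Y ⟶ X) (hir : i ≫ r = 𝟙 X) (hY : AddClos 𝒮 Y) :
      AddClos 𝒮 X

/-- `add 𝒮` as a set. -/
def addSet (𝒮 : Set C) : Set C := {X | AddClos 𝒮 X}

/-- `𝒮` is a `P`-presentation of `ℳ ⊆ d-H`: a `(d+1)`-term subcategory of `K`
with `add H^{[-d+1,0]}(𝒮) = ℳ`. -/
def IsPPresentation (P : Set C) (d : ℕ) (ℳ 𝒮 : Set C) : Prop :=
  𝒮 ⊆ intervalFrom P 0 d ∧ addSet (hTruncSet P d 𝒮) = ℳ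

/-- `ℳ` is AIR tilting with respect to its `P`-presentation `𝒮`. -/
def IsAIRTiltingWrt (P : Set C) (d : ℕ) (ℳ 𝒮 : Set C) : Prop :=
  IsPPresentation P d ℳ 𝒮 ∧ ContravariantlyFinite 𝒮 ∧ TClass P d 𝒮 = Fac P d ℳ d

/-- `ℳ` is AIR tilting. -/
def IsAIRTilting (P : Set C) (d : ℕ) (ℳ : Set C) : Prop :=
  ∃ 𝒮 : Set C, IsAIRTiltingWrt P d ℳ 𝒮

/-- `ℳ` is a quasi-tilting subcategory of the `d`-extended heart. -/
def IsQuasiTilting (P : Set C) (d : ℕ) (ℳ : Set C) : Prop :=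
  (∀ M ∈ ℳ, ∀ X ∈ Fac P d ℳ d, ∀ f : M ⟶ X⟦(1 : ℤ)⟧, f = 0) ∧
  Fac P d ℳ d = Fac P d ℳ (d + 1)

/-- `M ∈ d-H` has projective dimension at most `m`. -/
def ProjDimLE (P : Set C) (d : ℕ) : ℕ → C → Prop
  | 0, M => M ∈ P
  | m + 1, M => ∃ (Z Q : C), Q ∈ P ∧ ProjDimLE P d m Z ∧ Extriangle P d Z Q M

/-- `ℳ` is a tilting subcategory of the `d`-extended heart. -/
def IsTilting (P : Set C) (d : ℕ) (ℳ : Set C) : Prop :=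
  (∀ M ∈ ℳ, ProjDimLE P d d M) ∧
  (∀ M ∈ ℳ, ∀ M' ∈ ℳ, ∀ i : ℤ, 0 < i → ∀ f : M ⟶ M'⟦i⟧, f = 0) ∧
  (∀ Q ∈ P, ∃ (r : ℕ) (Y : ℕ → C) (M : ℕ → C), Y 0 = Q ∧ Y r ∈ ℳ ∧
      ∀ i < r, M i ∈ ℳ ∧ Extriangle P d (Y i) (M i) (Y (i + 1)))

/-- `ℳ` is an `E`-universal subcategory of the `d`-extended heart. -/
def EUniversal (P : Set C) (d : ℕ) (ℳ : Set C) : Prop :=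
  ∀ X ∈ extHeart P d, ∃ (Y M : C) (_ : M ∈ ℳ) (f : X ⟶ Y) (g : Y ⟶ M)
      (h : M ⟶ X⟦(1 : ℤ)⟧), Triangle.mk f g h ∈ (distTriang C) ∧ Y ∈ extHeart P d ∧
      ∀ M' ∈ ℳ, ∀ e : M' ⟶ X⟦(1 : ℤ)⟧, ∃ φ : M' ⟶ M, φ ≫ h = e

/-- There are no nonzero morphisms from `X` to `Y⟦i⟧`. -/
def HomVanish (X Y : C) (i : ℤ) : Prop := ∀ f : X ⟶ Y⟦i⟧, f = 0

omit [HasZeroObject C] [HasShift C ℤ] [∀ n : ℤ, (shiftFunctor C n).Additive]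
  [Pretriangulated C] in
theorem hom_eq_zero_of_iso {X X' Y Y' : C} (e : X ≅ X') (e' : Y ≅ Y')
    (h : ∀ f : X ⟶ Y, f = 0) (f : X' ⟶ Y') : f = 0 := by
  have h₁ : f = e.inv ≫ (e.hom ≫ f ≫ e'.inv) ≫ e'.hom := by simp
  rw [h₁, h (e.hom ≫ f ≫ e'.inv)]
  simp

omit [HasZeroObject C] [Pretriangulated C] in
theorem hom_shift_eq_zero_iff {X Y : C} (n : ℤ) :
    (∀ f : X⟦n⟧ ⟶ Y⟦n⟧, f = 0) ↔ ∀ f : X ⟶ Y, f = 0 := by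
  constructor
  · intro h f
    apply (shiftFunctor C n).map_injective
    rw [h ((shiftFunctor C n).map f), Functor.map_zero]
  · intro h f
    rw [← (shiftFunctor C n).map_preimage f, h ((shiftFunctor C n).preimage f),
      Functor.map_zero]

omit [HasZeroObject C] [∀ n : ℤ, (shiftFunctor C n).Additive] [Pretriangulated C] in
theorem HomVanish.of_iso {X X' Y Y' : C} {i : ℤ} (h : HomVanish X Y i) (e : X ≅ X')
    (e' : Y ≅ Y') : HomVanish X' Y' i :=
  hom_eq_zero_of_iso e ((shiftFunctor C i).mapIso e') h

omit [HasZeroObject C] [∀ n : ℤ, (shiftFunctor C n).Additive] [Pretriangulated C] in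
theorem homVanish_shift_right_iff {X Y : C} {a i j : ℤ} (h : a + i = j) :
    HomVanish X (Y⟦a⟧) i ↔ HomVanish X Y j :=
  let e := (shiftFunctorAdd' C a i j h).app Y
  ⟨hom_eq_zero_of_iso (Iso.refl X) e.symm, hom_eq_zero_of_iso (Iso.refl X) e⟩

omit [HasZeroObject C] [Pretriangulated C] in
theorem homVanish_shift_left_iff {X Y : C} {a i j : ℤ} (h : j + a = i) :
    HomVanish (X⟦a⟧) Y i ↔ HomVanish X Y j :=
  let e := (shiftFunctorAdd' C j a i h).app Y
  ⟨fun H => (hom_shift_eq_zero_iff a).1 (hom_eq_zero_of_iso (Iso.refl _) e H),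
    fun H => hom_eq_zero_of_iso (Iso.refl _) e.symm ((hom_shift_eq_zero_iff a).2 H)⟩

omit [HasZeroObject C] [∀ n : ℤ, (shiftFunctor C n).Additive] [Pretriangulated C] in
theorem homVanish_zero_iff {X Y : C} : HomVanish X Y 0 ↔ ∀ f : X ⟶ Y, f = 0 :=
  let e := (shiftFunctorZero C ℤ).app Y
  ⟨hom_eq_zero_of_iso (Iso.refl X) e, hom_eq_zero_of_iso (Iso.refl X) e.symm⟩

omit [HasZeroObject C] [Pretriangulated C] in
theorem homVanish_iff_unshift {X Y : C} {i : ℤ} :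
    HomVanish X Y i ↔ ∀ f : X⟦-i⟧ ⟶ Y, f = 0 := by
  rw [← homVanish_zero_iff, homVanish_shift_left_iff (add_neg_cancel i)]

omit [HasZeroObject C] [Pretriangulated C] in
theorem HomVanish.of_isZero {X Y : C} {i : ℤ} (h : IsZero Y) : HomVanish X Y i :=
  homVanish_iff_unshift.2 fun _ => h.eq_of_tgt _ _

omit [HasZeroObject C] [∀ n : ℤ, (shiftFunctor C n).Additive] [Pretriangulated C] in
theorem HomVanish.of_isZero_left {X Y : C} {i : ℤ} (h : IsZero X) : HomVanish X Y i :=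
  fun _ => h.eq_of_src _ _

omit [HasZeroObject C] [Pretriangulated C] in
/-- Vanishing for `Y` passes to any `Z` whose identity factors through copies of `Y` and `Y'`. -/
theorem HomVanish.of_id_eq_add {X Y Y' Z : C} {k : ℤ} (i : Z ⟶ Y) (r : Y ⟶ Z) (i' : Z ⟶ Y')
    (r' : Y' ⟶ Z) (h : i ≫ r + i' ≫ r' = 𝟙 Z) (hY : HomVanish X Y k) (hY' : HomVanish X Y' k) :
    HomVanish X Z k := by
  rw [homVanish_iff_unshift] at *
  intro f
  rw [← Category.comp_id f, ← h, Preadditive.comp_add, ← Category.assoc, hY (f ≫ i),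
    ← Category.assoc, hY' (f ≫ i'), zero_comp, zero_comp, add_zero]

section Triangle

variable {A B Z : C} {f : A ⟶ B} {g : B ⟶ Z} {h : Z ⟶ A⟦(1 : ℤ)⟧}

theorem HomVanish.middle (hT : Triangle.mk f g h ∈ distTriang C) {X : C} {i : ℤ}
    (hA : HomVanish X A i) (hZ : HomVanish X Z i) : HomVanish X B i := by
  rw [homVanish_iff_unshift] at *
  intro u
  obtain ⟨v, rfl⟩ := Triangle.coyoneda_exact₂ _ hT u (hZ _)
  rw [hA v]
  exact zero_comp

theorem HomVanish.right (hT : Triangle.mk f g h ∈ distTriang C) {X : C} {i : ℤ}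
    (hB : HomVanish X B i) (hA : HomVanish X A (i + 1)) : HomVanish X Z i := by
  rw [← homVanish_shift_right_iff (add_comm 1 i)] at hA
  rw [homVanish_iff_unshift] at *
  intro u
  obtain ⟨v, rfl⟩ := Triangle.coyoneda_exact₃ _ hT u (hA _)
  rw [hB v]
  exact zero_comp

theorem HomVanish.left (hT : Triangle.mk f g h ∈ distTriang C) {X : C} {i : ℤ}
    (hB : HomVanish X B i) (hZ : HomVanish X Z (i - 1)) : HomVanish X A i := by
  rw [← homVanish_shift_right_iff (add_sub_cancel 1 i)] at hB ⊢
  rw [homVanish_iff_unshift] at *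
  intro u
  obtain ⟨v, rfl⟩ := Triangle.coyoneda_exact₁ _ hT u (hB _)
  rw [hZ v]
  exact zero_comp

theorem HomVanish.left_one_of_lift (hT : Triangle.mk f g h ∈ distTriang C) {X : C}
    (hB : HomVanish X B 1) (hg : ∀ u : X ⟶ Z, ∃ v : X ⟶ B, v ≫ g = u) : HomVanish X A 1 := by
  intro u
  obtain ⟨v, rfl⟩ := Triangle.coyoneda_exact₁ _ hT u (hB _)
  obtain ⟨w, rfl⟩ := hg v
  exact (Category.assoc _ _ _).trans
    ((congrArg (w ≫ ·) (comp_distTriang_mor_zero₂₃ _ hT)).trans comp_zero)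

theorem HomVanish.middle_source (hT : Triangle.mk f g h ∈ distTriang C) {Y : C} {i : ℤ}
    (hA : HomVanish A Y i) (hZ : HomVanish Z Y i) : HomVanish B Y i := by
  intro u
  obtain ⟨v, rfl⟩ := Triangle.yoneda_exact₂ _ hT u (hA _)
  rw [hZ v]
  exact comp_zero

theorem HomVanish.right_source (hT : Triangle.mk f g h ∈ distTriang C) {Y : C} {i j : ℤ}
    (hij : j + 1 = i) (hB : HomVanish B Y i) (hA : HomVanish A Y j) : HomVanish Z Y i := by
  intro u
  obtain ⟨v, rfl⟩ := Triangle.yoneda_exact₃ _ hT u (hB _)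
  rw [(homVanish_shift_left_iff hij).2 hA v]
  exact comp_zero

end Triangle

omit [HasZeroObject C] [∀ n : ℤ, (shiftFunctor C n).Additive] [Pretriangulated C] in
theorem shift_mem_leZeroSet_iff {𝒳 : Set C} {Y : C} {n : ℤ} :
    Y⟦n⟧ ∈ leZeroSet 𝒳 ↔ ∀ X ∈ 𝒳, ∀ i : ℤ, n < i → HomVanish X Y i := by
  refine ⟨fun H X hX i hi => ?_, fun H X hX i hi => ?_⟩
  · exact (homVanish_shift_right_iff (add_sub_cancel n i)).1 (H X hX (i - n) (by lia))
  · exact (homVanish_shift_right_iff rfl).2 (H X hX (n + i) (by lia))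

omit [HasZeroObject C] [∀ n : ℤ, (shiftFunctor C n).Additive] [Pretriangulated C] in
theorem shift_mem_geZeroSet_iff {𝒳 : Set C} {Y : C} {n : ℤ} :
    Y⟦n⟧ ∈ geZeroSet 𝒳 ↔ ∀ X ∈ 𝒳, ∀ i : ℤ, i < n → HomVanish X Y i := by
  refine ⟨fun H X hX i hi => ?_, fun H X hX i hi => ?_⟩
  · exact (homVanish_shift_right_iff (add_sub_cancel n i)).1 (H X hX (i - n) (by lia))
  · exact (homVanish_shift_right_iff rfl).2 (H X hX (n + i) (by lia))

omit [HasZeroObject C] [∀ n : ℤ, (shiftFunctor C n).Additive] [Pretriangulated C] in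
theorem mem_extHeart_iff {P : Set C} {d : ℕ} {X : C} :
    X ∈ extHeart P d ↔ X ∈ leZeroSet P ∧
      ∀ Q ∈ P, ∀ i : ℤ, i < 1 - (d : ℤ) → HomVanish Q X i := by
  rw [← shift_mem_geZeroSet_iff]
  rfl

omit [HasZeroObject C] [∀ n : ℤ, (shiftFunctor C n).Additive] [Pretriangulated C] in
theorem mem_TClass_iff {P S : Set C} {d : ℕ} {X : C} :
    X ∈ TClass P d S ↔ X ∈ extHeart P d ∧ X ∈ leZeroSet S := Iff.rfl

/-- If `P` is presilting then `Hom(P, X[i])` vanishes in positive degrees on `P^{[p, p+n]}`,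
`p ≥ 0`. -/
theorem intervalFrom_subset_leZeroSet {P : Set C} (hP : IsPresilting P) :
    ∀ (n : ℕ) (p : ℤ), 0 ≤ p → intervalFrom P p n ⊆ leZeroSet P := by
  have base : ∀ p : ℤ, 0 ≤ p → shiftSet P p ⊆ leZeroSet P := by
    rintro p hp X ⟨Y, hY, ⟨e⟩⟩ Q hQ i hi
    exact HomVanish.of_iso ((homVanish_shift_right_iff rfl).2 (hP Q hQ Y hY (p + i) (by lia)))
      (Iso.refl _) e.symm
  intro n
  induction n with
  | zero => exact base
  | succ n ih =>
    rintro p hp X ⟨A, B, hA, hB, f, g, h, hT⟩ Q hQ i hi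
    exact HomVanish.middle hT (base p hp hA Q hQ i hi) (ih (p + 1) (by lia) hB Q hQ i hi)

/-- `Hom(X, W[i])` vanishes for `X ∈ P^{[p, p+n]}`, `i ≥ 1` and `W ∈ D^{≤ -p-n}`. -/
theorem homVanish_of_mem_intervalFrom {P : Set C} {W : C} :
    ∀ (n : ℕ) (p : ℤ) {X : C}, X ∈ intervalFrom P p n → W⟦-(p + n)⟧ ∈ leZeroSet P →
      ∀ i : ℤ, 0 < i → HomVanish X W i := by
  have base : ∀ (p q : ℤ) {X : C}, X ∈ shiftSet P p → p ≤ q → W⟦-q⟧ ∈ leZeroSet P →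
      ∀ i : ℤ, 0 < i → HomVanish X W i := by
    rintro p q X ⟨Y, hY, ⟨e⟩⟩ hpq hW i hi
    rw [shift_mem_leZeroSet_iff] at hW
    exact HomVanish.of_iso ((homVanish_shift_left_iff (sub_add_cancel i p)).2
      (hW Y hY (i - p) (by lia))) e.symm (Iso.refl _)
  intro n
  induction n with
  | zero =>
    intro p X hX hW
    exact base p _ hX (by simp) hW
  | succ n ih =>
    rintro p X ⟨A, B, hA, hB, f, g, h, hT⟩ hW i hi
    refine HomVanish.middle_source hT (base p _ hA (by lia) hW i hi) (ih (p + 1) hB ?_ i hi)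
    rwa [show p + 1 + (n : ℤ) = p + ((n + 1 : ℕ) : ℤ) by push_cast; ring]

/-- The cocone of a right approximation by a presilting class stays in the aisle. -/
theorem exists_approx_triangle {S : Set C} (hS : IsPresilting S) (hcf : ContravariantlyFinite S)
    {Y : C} (hY : Y ∈ leZeroSet S) :
    ∃ (W A : C) (f : W ⟶ A) (g : A ⟶ Y) (h : Y ⟶ W⟦(1 : ℤ)⟧),
      Triangle.mk f g h ∈ distTriang C ∧ W ∈ leZeroSet S ∧ IsRightApprox S g := by
  obtain ⟨A, g, hg⟩ := hcf Y
  obtain ⟨W, f, h, hT⟩ := distinguished_cocone_triangle₁ g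
  refine ⟨W, A, f, g, h, hT, fun B hB i hi => ?_, hg⟩
  obtain rfl | hi' := eq_or_lt_of_le (show 1 ≤ i by lia)
  · exact HomVanish.left_one_of_lift hT (hS B hB A hg.1 1 hi) (hg.2 B hB)
  · exact HomVanish.left hT (hS B hB A hg.1 i hi) (hY B hB (i - 1) (by lia))

/-- On the triangulated subcategory generated by `S`, morphisms to `D_S^{≤ 0}` vanish in large
degrees. -/
theorem isTriangSub_eventually_homVanish (S : Set C) :
    IsTriangSub {X : C | ∃ n : ℤ, ∀ Y ∈ leZeroSet S, ∀ i : ℤ, n < i → HomVanish X Y i} where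
  iso_closed := by
    rintro X X' e ⟨n, hn⟩
    exact ⟨n, fun Y hY i hi => (hn Y hY i hi).of_iso e (Iso.refl _)⟩
  zero_mem X hX := ⟨0, fun Y _ i _ => HomVanish.of_isZero_left hX⟩
  shift_mem := by
    rintro X ⟨n, hn⟩
    exact ⟨n + 1, fun Y hY i hi => (homVanish_shift_left_iff (sub_add_cancel i 1)).2
      (hn Y hY (i - 1) (by lia))⟩
  unshift_mem := by
    rintro X ⟨n, hn⟩
    exact ⟨n - 1, fun Y hY i hi => (homVanish_shift_left_iff (add_neg_cancel_right i 1)).2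
      (hn Y hY (i + 1) (by lia))⟩
  ext_mem := by
    rintro T hT ⟨n₁, hn₁⟩ ⟨n₃, hn₃⟩
    exact ⟨max n₁ n₃, fun Y hY i hi => HomVanish.middle_source (f := T.mor₁) (g := T.mor₂)
      (h := T.mor₃) hT (hn₁ Y hY i (by lia)) (hn₃ Y hY i (by lia))⟩

theorem leZeroSet_subset_of_isSiltingIn {P S : Set C} (hS : IsSiltingIn (thickClosure P) S)
    (hSP : S ⊆ leZeroSet P) (hcf : ContravariantlyFinite S) : leZeroSet S ⊆ leZeroSet P := by
  intro Y hY Q hQ i hi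
  obtain ⟨n, hn⟩ := hS.2.2 _ (isTriangSub_eventually_homVanish S)
    (fun X hX => ⟨0, fun Y hY i hi => hY X hX i hi⟩) (fun T _ hT => hT hQ : Q ∈ thickClosure P)
  have key : ∀ (k : ℕ) (i : ℤ) (Y : C), Y ∈ leZeroSet S → 0 < i → n < i + k →
      HomVanish Q Y i := by
    intro k
    induction k with
    | zero => exact fun i Y hY _ hin => hn Y hY i (by simpa using hin)
    | succ k ih =>
      intro i Y hY hi hin
      obtain ⟨W, A, f, g, h, hT, hW, hg⟩ := exists_approx_triangle hS.2.1 hcf hY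
      exact HomVanish.right hT (hSP hg.1 Q hQ i hi) (ih (i + 1) W hW (by lia) (by lia))
  exact key (n - i + 1).toNat i Y hY hi (by lia)

theorem exists_distinguished_of_iso {T : Triangle C} (hT : T ∈ distTriang C) {A : C}
    (e : T.obj₂ ≅ A) : ∃ (f : T.obj₁ ⟶ A) (g : A ⟶ T.obj₃) (h : T.obj₃ ⟶ T.obj₁⟦(1 : ℤ)⟧),
      Triangle.mk f g h ∈ distTriang C :=
  ⟨T.mor₁ ≫ e.hom, e.inv ≫ T.mor₂, T.mor₃, isomorphic_distinguished _ hT _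
    (Triangle.isoMk _ _ (Iso.refl _) e.symm (Iso.refl _)
      (show (T.mor₁ ≫ e.hom) ≫ e.inv = 𝟙 T.obj₁ ≫ T.mor₁ by simp)
      (show (e.inv ≫ T.mor₂) ≫ 𝟙 T.obj₃ = e.inv ≫ T.mor₂ by simp)
      (show T.mor₃ ≫ (𝟙 T.obj₁)⟦(1 : ℤ)⟧' = 𝟙 T.obj₃ ≫ T.mor₃ by simp))⟩

section Truncation

variable {P S : Set C} {d : ℕ}

theorem hom_eq_zero_of_mem_extHeart (hP : IsTStr (leZeroSet P) (geZeroSet P)) {W X : C}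
    (hW : W⟦-(d : ℤ)⟧ ∈ leZeroSet P) (hX : X ∈ extHeart P d) (f : W ⟶ X) : f = 0 := by
  refine (hom_shift_eq_zero_iff (-(d : ℤ))).1 (hP.hom_zero _ hW _ ?_) f
  exact hP.iso_ge _ _ ((shiftFunctorAdd' C (-(d : ℤ)) 1 (1 - d) (by ring)).app X) hX.2

theorem IsHTrunc.mem_leZeroSet (hterm : S ⊆ intervalFrom P 0 d) (hS : IsPresilting S) {A M : C}
    (hA : A ∈ S) (hM : IsHTrunc P d A M) : M ∈ leZeroSet S := by
  obtain ⟨-, W, f, g, h, hT, hW⟩ := hM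
  intro B hB i hi
  exact HomVanish.right hT (hS B hB A hA i hi)
    (homVanish_of_mem_intervalFrom d 0 (hterm hB) (by simpa using hW) (i + 1) (by lia))

theorem exists_isHTrunc (hP : IsTStr (leZeroSet P) (geZeroSet P)) {A : C}
    (hA : A ∈ leZeroSet P) : ∃ M, IsHTrunc P d A M := by
  obtain ⟨U, V, f, g, h, hT, hU, hV⟩ := hP.exists_tri (A⟦-(d : ℤ)⟧)
  have hV' : V⟦(d : ℤ)⟧⟦(1 - d : ℤ)⟧ ∈ geZeroSet P :=
    hP.iso_ge _ _ ((shiftFunctorAdd' C (d : ℤ) (1 - d) 1 (by ring)).app V) hV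
  have hU' : U⟦(d : ℤ)⟧⟦-(d : ℤ)⟧ ∈ leZeroSet P :=
    hP.iso_le _ _ ((shiftFunctorCompIsoId C (d : ℤ) (-d) (by simp)).symm.app U) hU
  obtain ⟨f', g', h', hT'⟩ := exists_distinguished_of_iso
    (Triangle.shift_distinguished _ hT (d : ℤ))
    ((shiftFunctorCompIsoId C (-(d : ℤ)) d (by simp)).app A)
  refine ⟨V⟦(d : ℤ)⟧, ⟨fun Q hQ i hi => ?_, hV'⟩, U⟦(d : ℤ)⟧, f', g', h', hT', hU'⟩
  exact HomVanish.right hT' (hA Q hQ i hi)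
    (shift_mem_leZeroSet_iff.1 hU' Q hQ (i + 1) (by lia))

/-- Morphisms from a truncation of an object of `S` to `X[1]` vanish for `X ∈ T(S)`. -/
theorem IsHTrunc.homVanish_one (hP : IsTStr (leZeroSet P) (geZeroSet P)) {A M X : C} (hA : A ∈ S)
    (hM : IsHTrunc P d A M) (hX : X ∈ TClass P d S) : HomVanish M X 1 := by
  obtain ⟨-, W, f, g, h, hT, hW⟩ := hM
  exact HomVanish.right_source hT (zero_add 1) (hX.2 A hA 1 one_pos)
    (homVanish_zero_iff.2 (hom_eq_zero_of_mem_extHeart hP hW hX.1))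

/-- A right `S`-approximation of `X ∈ T(S)` factors through the truncation, and the cocone of the
factorisation stays in `T(S)`. -/
theorem exists_extriangle_of_mem_TClass (hP : IsTStr (leZeroSet P) (geZeroSet P))
    (hterm : S ⊆ intervalFrom P 0 d) (hS : IsPresilting S) (hcf : ContravariantlyFinite S)
    (hSP : S ⊆ leZeroSet P) (hle : leZeroSet S ⊆ leZeroSet P) {X : C} (hX : X ∈ TClass P d S) :
    ∃ (A : C) (_ : A ∈ S) (M Z : C), IsHTrunc P d A M ∧
      Z ∈ TClass P d S ∧ Extriangle P d Z M X := by
  obtain ⟨A, p, hA, hp⟩ := hcf X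
  obtain ⟨M, hM⟩ := exists_isHTrunc (d := d) hP (hSP hA)
  have hMS := hM.mem_leZeroSet hterm hS hA
  have hM' := hM
  obtain ⟨hMH, W, f, g, h, hT, hW⟩ := hM'
  obtain ⟨q, hq⟩ : ∃ q : M ⟶ X, p = g ≫ q :=
    Triangle.yoneda_exact₂ _ hT p (hom_eq_zero_of_mem_extHeart hP hW hX.1 _)
  obtain ⟨Z, a, b, hZ⟩ := distinguished_cocone_triangle₁ q
  have hZS : Z ∈ leZeroSet S := by
    intro B hB i hi
    obtain rfl | hi' := eq_or_lt_of_le (show 1 ≤ i by lia)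
    · refine HomVanish.left_one_of_lift hZ (hMS B hB 1 hi) fun u => ?_
      obtain ⟨v, rfl⟩ := hp B hB u
      exact ⟨v ≫ g, by rw [hq, Category.assoc]⟩
    · exact HomVanish.left hZ (hMS B hB i hi) (hX.2 B hB (i - 1) (by lia))
  have hZH : Z ∈ extHeart P d := mem_extHeart_iff.2 ⟨hle hZS, fun Q hQ i hi =>
    HomVanish.left hZ ((mem_extHeart_iff.1 hMH).2 Q hQ i hi)
      ((mem_extHeart_iff.1 hX.1).2 Q hQ (i - 1) (by lia))⟩
  exact ⟨A, hA, M, Z, hM, ⟨hZH, hZS⟩, hZH, hMH, hX.1, a, q, b, hZ⟩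

omit [HasZeroObject C] [Pretriangulated C] in
/-- `T(S)` is closed under finite direct sums and direct summands. -/
theorem mem_TClass_of_id_eq_add {Y Y' Z : C} (i : Z ⟶ Y) (r : Y ⟶ Z) (i' : Z ⟶ Y')
    (r' : Y' ⟶ Z) (h : i ≫ r + i' ≫ r' = 𝟙 Z) (hY : Y ∈ TClass P d S)
    (hY' : Y' ∈ TClass P d S) : Z ∈ TClass P d S := by
  rw [mem_TClass_iff, mem_extHeart_iff] at *
  exact ⟨⟨fun Q hQ k hk => HomVanish.of_id_eq_add i r i' r' h (hY.1.1 Q hQ k hk) (hY'.1.1 Q hQ k hk),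
    fun Q hQ k hk => HomVanish.of_id_eq_add i r i' r' h (hY.1.2 Q hQ k hk) (hY'.1.2 Q hQ k hk)⟩,
    fun Q hQ k hk => HomVanish.of_id_eq_add i r i' r' h (hY.2 Q hQ k hk) (hY'.2 Q hQ k hk)⟩

theorem addSet_hTruncSet_subset (hP : IsTStr (leZeroSet P) (geZeroSet P))
    (hterm : S ⊆ intervalFrom P 0 d) (hS : IsPresilting S) :
    addSet (hTruncSet P d S) ⊆
      {M | M ∈ TClass P d S ∧ ∀ X ∈ TClass P d S, HomVanish M X 1} := by
  intro M hM
  induction hM with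
  | of M hM =>
    obtain ⟨A, hA, hAM⟩ := hM
    exact ⟨⟨hAM.1, hAM.mem_leZeroSet hterm hS hA⟩, fun X hX => hAM.homVanish_one hP hA hX⟩
  | zero M hM =>
    exact ⟨mem_TClass_iff.2 ⟨mem_extHeart_iff.2 ⟨fun _ _ _ _ => HomVanish.of_isZero hM,
      fun _ _ _ _ => HomVanish.of_isZero hM⟩, fun _ _ _ _ => HomVanish.of_isZero hM⟩,
      fun X hX => HomVanish.of_isZero_left hM⟩
  | biprod X Y Z i₁ i₂ p₁ p₂ h₁ h₂ h₁₂ h₂₁ htot hX hY ihX ihY =>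
    refine ⟨mem_TClass_of_id_eq_add p₁ i₁ p₂ i₂ htot ihX.1 ihY.1, fun W hW f => ?_⟩
    rw [← Category.id_comp f, ← htot, Preadditive.add_comp, Category.assoc, Category.assoc,
      ihX.2 W hW (i₁ ≫ f), ihY.2 W hW (i₂ ≫ f), comp_zero, comp_zero, add_zero]
  | summand X Y i r hir hY ihY =>
    refine ⟨mem_TClass_of_id_eq_add i r 0 r (by simp [hir]) ihY.1 ihY.1, fun W hW f => ?_⟩
    rw [← Category.id_comp f, ← hir, Category.assoc, ihY.2 W hW (r ≫ f), comp_zero]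

theorem Fac_homVanish {𝒳 : Set C} (h𝒳 : 𝒳 ⊆ leZeroSet S) :
    ∀ (s : ℕ) {Z : C}, Z ∈ Fac P d 𝒳 s → ∃ W ∈ extHeart P d, ∀ B ∈ S, ∀ i : ℤ, 0 < i →
      HomVanish B W (i + s) → HomVanish B Z i := by
  intro s
  induction s with
  | zero => exact fun {Z} hZ => ⟨Z, hZ, fun B _ i _ H => by simpa using H⟩
  | succ s ih =>
    rintro Z ⟨Z', hZ', X, hX, -, -, -, f, g, h, hT⟩
    obtain ⟨W, hW, H⟩ := ih hZ'
    refine ⟨W, hW, fun B hB i hi hBW => HomVanish.right hT (h𝒳 hX B hB i hi)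
      (H B hB (i + 1) (by lia) ?_)⟩
    rwa [show i + 1 + (s : ℤ) = i + ((s + 1 : ℕ) : ℤ) by push_cast; ring]

theorem Fac_subset_extHeart {𝒳 : Set C} : ∀ s : ℕ, Fac P d 𝒳 s ⊆ extHeart P d
  | 0 => subset_rfl
  | _ + 1 => fun _ ⟨_, _, _, _, h⟩ => h.2.2.1

theorem Fac_subset_TClass (hterm : S ⊆ intervalFrom P 0 d) {𝒳 : Set C}
    (h𝒳 : 𝒳 ⊆ leZeroSet S) {s : ℕ} (hs : d ≤ s) : Fac P d 𝒳 s ⊆ TClass P d S := by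
  intro Z hZ
  obtain ⟨W, hW, H⟩ := Fac_homVanish h𝒳 s hZ
  refine ⟨Fac_subset_extHeart s hZ, fun B hB i hi => H B hB i hi ?_⟩
  have hW' : W⟦(d : ℤ)⟧⟦-(0 + (d : ℤ))⟧ ∈ leZeroSet P :=
    shift_mem_leZeroSet_iff.2 fun Q hQ j hj =>
      (homVanish_shift_right_iff rfl).2 (hW.1 Q hQ (d + j) (by lia))
  exact (homVanish_shift_right_iff (by lia)).1
    (homVanish_of_mem_intervalFrom d 0 (hterm hB) hW' (i + s - d) (by lia))

theorem subset_Fac {𝒯 𝒳 : Set C} (h𝒯 : 𝒯 ⊆ extHeart P d)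
    (h : ∀ X ∈ 𝒯, ∃ Z ∈ 𝒯, ∃ M ∈ 𝒳, Extriangle P d Z M X) (s : ℕ) : 𝒯 ⊆ Fac P d 𝒳 s := by
  induction s with
  | zero => exact h𝒯
  | succ s ih =>
    intro X hX
    obtain ⟨Z, hZ, M, hM, hE⟩ := h X hX
    exact ⟨Z, ih hZ, M, hM, hE⟩

end Truncation

theorem statement7
    (P : Set C) (hPpre : IsPresilting P) (m : ℤ) (hm : m < 0)
    (hP1 : ∀ X ∈ P, ∀ Y ∈ P, ∀ i : ℤ, i < m → ∀ f : X ⟶ Y⟦i⟧, f = 0)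
    (hP2 : IsTStr (leZeroSet P) (geZeroSet P))
    (d : ℕ) (hd : 0 < d)
    (S : Set C) (hterm : S ⊆ intervalFrom P 0 d)
    (hsilt : IsSiltingIn (thickClosure P) S) (hcf : ContravariantlyFinite S) :
    (∀ X ∈ TClass P d S, ∃ (A : C) (_ : A ∈ S) (M Z : C), IsHTrunc P d A M ∧
        Z ∈ TClass P d S ∧ Extriangle P d Z M X) ∧
    (TClass P d S = Fac P d (addSet (hTruncSet P d S)) d ∧
      TClass P d S = Fac P d (addSet (hTruncSet P d S)) (d + 1)) ∧
    (addSet (hTruncSet P d S) =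
      {M | M ∈ TClass P d S ∧ ∀ X ∈ TClass P d S, ∀ f : M ⟶ X⟦(1 : ℤ)⟧, f = 0}) := by
  have hSP : S ⊆ leZeroSet P :=
    hterm.trans (intervalFrom_subset_leZeroSet hPpre d 0 le_rfl)
  have hle := leZeroSet_subset_of_isSiltingIn hsilt hSP hcf
  have hext : ∀ X ∈ TClass P d S, ∃ (A : C) (_ : A ∈ S) (M Z : C), IsHTrunc P d A M ∧
      Z ∈ TClass P d S ∧ Extriangle P d Z M X := fun X hX =>
    exists_extriangle_of_mem_TClass hP2 hterm hsilt.2.1 hcf hSP hle hX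
  have hadd := addSet_hTruncSet_subset hP2 hterm hsilt.2.1
  have hFac : ∀ s, d ≤ s → TClass P d S = Fac P d (addSet (hTruncSet P d S)) s := by
    refine fun s hs => Set.Subset.antisymm (subset_Fac (fun X hX => hX.1) (fun X hX => ?_) s)
      (Fac_subset_TClass hterm (fun M hM => (hadd hM).1.2) hs)
    obtain ⟨A, hA, M, Z, hM, hZ, hE⟩ := hext X hX
    exact ⟨Z, hZ, M, .of M ⟨A, hA, hM⟩, hE⟩
  refine ⟨hext, ⟨hFac d le_rfl, hFac (d + 1) d.le_succ⟩, Set.Subset.antisymm hadd ?_⟩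
  rintro X ⟨hX, hproj⟩
  obtain ⟨A, hA, M, Z, hM, hZ, -, -, -, f, g, h, hT⟩ := hext X hX
  obtain ⟨i, hi⟩ := Triangle.coyoneda_exact₃ _ hT (𝟙 X)
    ((Category.id_comp _).trans (hproj Z hZ h))
  exact .summand X M i g hi.symm (.of M ⟨A, hA, hM⟩)

end PaperAIR
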